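/- Let D be an exterior circular domain as above and f : closure(D) → ℂ continuous, holomorphic on D with f(ζ) = ζ + O(1/ζ) at infinity, f' ≠ 0 on closure(D), and f injective on ∂D with image curves Γ_k := f(∂B_ρ(ζ_k)) simple closed curves none of which encloses another. Then f is injective on D, and f maps D bijectively onto the unbounded component of the complement of ⋃_k Γ_k. -/

import Mathlib

open Complex Finset

/-- The unbounded component of the complement of a compact set `E ⊂ ℂ`: points not in
`E` whose connected component in `Eᶜ` is unbounded. -/
def unboundedComplementComponent (E : Set ℂ) : Set ℂ :=
  {z : ℂ | z ∉ E ∧ ¬ Bornology.IsBounded (connectedComponentIn Eᶜ z)}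


open Filter Topology Metric

/-- Winding number of `φ` along the circle is `n`. -/
def HasWind (c : ℂ) (r : ℝ) (φ : ℂ → ℂ) (n : ℤ) : Prop :=
  ∃ l : ℂ → ℂ, ContinuousOn l (Metric.sphere c r) ∧
    ∀ z ∈ Metric.sphere c r, φ z = (z - c) ^ n * Complex.exp (l z)

theorem exists_log {A : Type*} [TopologicalSpace A] [SimplyConnectedSpace A]
    [LocallyPathConnectedSpace A] (φ : A → ℂ) (hφ : Continuous φ) (h0 : ∀ a, φ a ≠ 0) :
    ∃ L : A → ℂ, Continuous L ∧ ∀ a, Complex.exp (L a) = φ a := by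
  obtain ⟨a₀⟩ : Nonempty A := inferInstance
  obtain ⟨F, ⟨-, hF⟩, -⟩ := Complex.isCoveringMapOn_exp.existsUnique_continuousMap_lifts
    (⟨φ, hφ⟩ : C(A, ℂ)) (a₀ := a₀) (e₀ := Complex.log (φ a₀))
    (by simp [Complex.exp_log (h0 a₀)]) (by intro a; simpa using h0 a)
  exact ⟨F, F.continuous, fun a => congrFun hF a⟩

/-- A continuous function with `exp = 1` is constant on a preconnected space. -/
theorem exp_one_const {A : Type*} [TopologicalSpace A] [PreconnectedSpace A]
    (g : A → ℂ) (hg : Continuous g) (h : ∀ a, Complex.exp (g a) = 1) (a₀ : A) :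
    ∃ n : ℤ, ∀ a, g a = n * (2 * Real.pi * Complex.I) := by
  choose n hn using fun a => Complex.exp_eq_one_iff.1 (h a)
  have hcont : Continuous n := by
    have h1 : Continuous (fun a => (n a : ℝ)) := by
      have : (fun a => (n a : ℝ)) = fun a => (g a).im / (2 * Real.pi) := by
        funext a
        rw [hn a]
        have := Real.pi_pos
        simp
      rw [this]
      fun_prop
    exact Int.isClosedEmbedding_coe_real.isInducing.continuous_iff.2 h1
  refine ⟨n a₀, fun a => ?_⟩
  rw [hn a, PreconnectedSpace.constant inferInstance hcont (x := a) (y := a₀)]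

theorem circ_mem {c : ℂ} {r : ℝ} (hr : 0 < r) (t : ℝ) :
    c + r * Complex.exp (t * Complex.I) ∈ Metric.sphere c r := by
  simp [Complex.norm_exp_ofReal_mul_I, abs_of_pos hr]

theorem hasWind_zero_unique {c : ℂ} {r : ℝ} (hr : 0 < r) {n : ℤ} {l : ℂ → ℂ}
    (hl : ContinuousOn l (Metric.sphere c r))
    (h : ∀ z ∈ Metric.sphere c r, (z - c) ^ n * Complex.exp (l z) = 1) : n = 0 := by
  let g : ℝ → ℂ := fun t => n * (Real.log r + t * Complex.I) +
    l (c + r * Complex.exp (t * Complex.I))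
  have hg : Continuous g := by
    have : Continuous (fun t : ℝ => l (c + r * Complex.exp (t * Complex.I))) :=
      hl.comp_continuous (by fun_prop) (fun t => circ_mem hr t)
    exact (by fun_prop : Continuous fun t : ℝ => (n : ℂ) * (Real.log r + t * Complex.I)).add this
  have h1 : ∀ t, Complex.exp (g t) = 1 := by
    intro t
    have := h _ (circ_mem hr t)
    rw [← this]
    simp only [g]
    rw [Complex.exp_add, Complex.exp_int_mul, Complex.exp_add, ← Complex.ofReal_exp,
      Real.exp_log hr]
    simp
  obtain ⟨m, hm⟩ := exp_one_const g hg h1 0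
  have e1 := hm 0
  have e2 := hm (2 * Real.pi)
  have e3 : g (2 * Real.pi) - g 0 = n * (2 * Real.pi * Complex.I) := by
    simp only [g]
    push_cast
    rw [Complex.exp_two_pi_mul_I]
    simp
    ring
  rw [e1, e2, sub_self] at e3
  have := Real.pi_pos.ne'
  have : (n : ℂ) = 0 := by
    have h2 : (2 * Real.pi * Complex.I : ℂ) ≠ 0 := Complex.two_pi_I_ne_zero
    simpa [h2, eq_comm] using e3
  exact_mod_cast this

theorem sphere_sub_ne {c z : ℂ} {r : ℝ} (hr : 0 < r) (hz : z ∈ Metric.sphere c r) : z - c ≠ 0 := by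
  intro h
  rw [sub_eq_zero] at h
  subst h
  simp at hz
  exact hr.ne hz

theorem HasWind.unique {c : ℂ} {r : ℝ} (hr : 0 < r) {φ : ℂ → ℂ} {n m : ℤ}
    (h1 : HasWind c r φ n) (h2 : HasWind c r φ m) : n = m := by
  obtain ⟨l, hl, e⟩ := h1
  obtain ⟨l', hl', e'⟩ := h2
  have := hasWind_zero_unique (n := n - m) hr (hl.sub hl') (by
    intro z hz
    have h0 := sphere_sub_ne hr hz
    have := (e z hz).symm.trans (e' z hz)
    simp only [Pi.sub_apply]
    rw [zpow_sub₀ h0, Complex.exp_sub, div_mul_div_comm, this, div_self]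
    exact mul_ne_zero (zpow_ne_zero _ h0) (Complex.exp_ne_zero _))
  omega

theorem HasWind.mul {c : ℂ} {r : ℝ} (hr : 0 < r) {φ ψ : ℂ → ℂ} {n m : ℤ}
    (h1 : HasWind c r φ n) (h2 : HasWind c r ψ m) :
    HasWind c r (fun z => φ z * ψ z) (n + m) := by
  obtain ⟨l, hl, e⟩ := h1
  obtain ⟨l', hl', e'⟩ := h2
  refine ⟨fun z => l z + l' z, hl.add hl', fun z hz => ?_⟩
  simp only
  rw [e z hz, e' z hz, zpow_add₀ (sphere_sub_ne hr hz), Complex.exp_add]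
  ring

theorem HasWind.zpow {c : ℂ} {r : ℝ} {φ : ℂ → ℂ} {n : ℤ}
    (h1 : HasWind c r φ n) (m : ℤ) : HasWind c r (fun z => φ z ^ m) (n * m) := by
  obtain ⟨l, hl, e⟩ := h1
  refine ⟨fun z => m * l z, by fun_prop, fun z hz => ?_⟩
  simp only
  rw [e z hz, mul_zpow, zpow_mul, ← Complex.exp_int_mul]

theorem HasWind.congr {c : ℂ} {r : ℝ} {φ ψ : ℂ → ℂ} {n : ℤ}
    (h1 : HasWind c r φ n) (h : ∀ z ∈ Metric.sphere c r, ψ z = φ z) : HasWind c r ψ n := by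
  obtain ⟨l, hl, e⟩ := h1
  exact ⟨l, hl, fun z hz => (h z hz).trans (e z hz)⟩

theorem HasWind.one {c : ℂ} {r : ℝ} : HasWind c r (fun _ => 1) 0 :=
  ⟨fun _ => 0, continuousOn_const, by simp⟩

theorem HasWind.const {c : ℂ} {r : ℝ} {a : ℂ} (ha : a ≠ 0) : HasWind c r (fun _ => a) 0 :=
  ⟨fun _ => Complex.log a, continuousOn_const, by simp [Complex.exp_log ha]⟩

theorem HasWind.prod {ι : Type*} {c : ℂ} {r : ℝ} (hr : 0 < r) (s : Finset ι) {φ : ι → ℂ → ℂ}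
    {n : ι → ℤ} (h : ∀ i ∈ s, HasWind c r (φ i) (n i)) :
    HasWind c r (fun z => ∏ i ∈ s, φ i z) (∑ i ∈ s, n i) := by
  classical
  induction s using Finset.induction_on with
  | empty => simpa using HasWind.one
  | insert a s ha ih =>
    simp only [Finset.prod_insert ha, Finset.sum_insert ha]
    exact (h a (by simp)).mul hr (ih fun i hi => h i (by simp [hi]))

theorem HasWind.center {c : ℂ} {r : ℝ} : HasWind c r (fun z => z - c) 1 :=
  ⟨fun _ => 0, continuousOn_const, by simp⟩

/-- Functions close to one have winding number zero. -/
theorem HasWind.of_close_one {c : ℂ} {r : ℝ} {φ : ℂ → ℂ}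
    (hφ : ContinuousOn φ (Metric.sphere c r)) (h : ∀ z ∈ Metric.sphere c r, ‖φ z - 1‖ < 1) :
    HasWind c r φ 0 := by
  have hs : ∀ z ∈ Metric.sphere c r, φ z ∈ Complex.slitPlane := by
    intro z hz
    have := Complex.mem_slitPlane_of_norm_lt_one (h z hz)
    simpa using this
  refine ⟨fun z => Complex.log (φ z), hφ.clog hs, fun z hz => ?_⟩
  simp [Complex.exp_log (Complex.slitPlane_ne_zero (hs z hz))]

theorem HasWind.of_close {c : ℂ} {r : ℝ} (hr : 0 < r) {φ ψ : ℂ → ℂ} {n : ℤ}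
    (hφ : ContinuousOn φ (Metric.sphere c r)) (hψ : ContinuousOn ψ (Metric.sphere c r))
    (h : ∀ z ∈ Metric.sphere c r, ‖ψ z - φ z‖ < ‖φ z‖) (hw : HasWind c r φ n) :
    HasWind c r ψ n := by
  have h0 : ∀ z ∈ Metric.sphere c r, φ z ≠ 0 := by
    intro z hz h1
    have := h z hz
    rw [h1, norm_zero] at this
    exact (norm_nonneg _).not_gt this
  have h1 : HasWind c r (fun z => ψ z / φ z) 0 := by
    refine HasWind.of_close_one (hψ.div hφ h0) fun z hz => ?_
    rw [div_sub_one (h0 z hz), norm_div, div_lt_one (norm_pos_iff.2 (h0 z hz))]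
    exact h z hz
  have := hw.mul hr h1
  rw [add_zero] at this
  refine this.congr fun z hz => ?_
  have := h0 z hz
  field_simp

theorem HasWind.sub_outside {c a : ℂ} {r : ℝ} (hr : 0 < r) (ha : r < dist a c) :
    HasWind c r (fun z => z - a) 0 := by
  have hne : c - a ≠ 0 := by
    intro h
    rw [sub_eq_zero] at h
    subst h
    simp at ha
    linarith
  refine HasWind.of_close hr (φ := fun _ => c - a) (by fun_prop) (by fun_prop) ?_
    (HasWind.const hne)
  intro z hz
  simp only [sub_sub_sub_cancel_right]
  rw [mem_sphere_iff_norm] at hz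
  rw [hz, ← dist_eq_norm, dist_comm]
  exact ha

theorem HasWind.of_lift {c : ℂ} {r : ℝ} (hr : 0 < r) {φ : ℂ → ℂ} {n : ℤ} {L : ℝ → ℂ}
    (hL : Continuous L) (hexp : ∀ t : ℝ, Complex.exp (L t) = φ (c + r * Complex.exp (t * Complex.I)))
    (hper : ∀ t, L (t + 2 * Real.pi) = L t + n * (2 * Real.pi * Complex.I)) :
    HasWind c r φ n := by
  let P : ℝ → ℂ := fun t => L t - n * (Real.log r + t * Complex.I)
  have hP : Function.Periodic P (2 * Real.pi) := by
    intro t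
    simp only [P, hper]
    push_cast
    ring
  have hPc : Continuous P := by fun_prop
  have hlift : Continuous (hP.lift : Real.Angle → ℂ) := by
    exact continuous_quot_lift _ hPc
  refine ⟨fun z => hP.lift ((Complex.arg (z - c) : ℝ) : Real.Angle), ?_, ?_⟩
  · intro z hz
    have h1 := Complex.continuousAt_arg_coe_angle (sphere_sub_ne hr hz)
    have h2 : ContinuousAt (fun z : ℂ => ((Complex.arg (z - c) : ℝ) : Real.Angle)) z :=
      ContinuousAt.comp (f := fun z : ℂ => z - c) (x := z) h1 (by fun_prop)
    exact (hlift.continuousAt.comp h2).continuousWithinAt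
  · intro z hz
    have h0 := sphere_sub_ne hr hz
    have hnorm : ‖z - c‖ = r := by rwa [mem_sphere_iff_norm] at hz
    have h3 := Complex.norm_mul_exp_arg_mul_I (z - c)
    rw [hnorm] at h3
    have h4 : hP.lift ((Complex.arg (z - c) : ℝ) : Real.Angle) = P (Complex.arg (z - c)) := rfl
    simp only [h4, P]
    rw [Complex.exp_sub, hexp, h3, Complex.exp_int_mul, Complex.exp_add, ← Complex.ofReal_exp,
      Real.exp_log hr, h3, add_sub_cancel, mul_div_cancel₀]
    exact zpow_ne_zero _ h0

theorem HasWind.exists {c : ℂ} {r : ℝ} (hr : 0 < r) {φ : ℂ → ℂ}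
    (hφ : ContinuousOn φ (Metric.sphere c r)) (h0 : ∀ z ∈ Metric.sphere c r, φ z ≠ 0) :
    ∃ n, HasWind c r φ n := by
  obtain ⟨L, hL, hexp⟩ := exists_log (fun t : ℝ => φ (c + r * Complex.exp (t * Complex.I)))
    (hφ.comp_continuous (by fun_prop) (fun t => circ_mem hr t)) (fun t => h0 _ (circ_mem hr t))
  obtain ⟨n, hn⟩ := exp_one_const (fun t => L (t + 2 * Real.pi) - L t) (by fun_prop) (by
    intro t
    rw [Complex.exp_sub, hexp, hexp]
    have : Complex.exp (((t + 2 * Real.pi : ℝ) : ℂ) * Complex.I) = Complex.exp (t * Complex.I) := by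
      push_cast
      rw [add_mul, Complex.exp_add, Complex.exp_two_pi_mul_I, mul_one]
    rw [this]
    exact div_self (h0 _ (circ_mem hr t))) 0
  exact ⟨n, HasWind.of_lift hr hL hexp fun t => by linear_combination hn t⟩


theorem HasWind.of_unbounded {c : ℂ} {r : ℝ} (hr : 0 < r) {φ : ℂ → ℂ}
    (hφ : ContinuousOn φ (Metric.sphere c r)) {w : ℂ} (hw : w ∉ φ '' Metric.sphere c r)
    (hub : ¬ Bornology.IsBounded (connectedComponentIn (φ '' Metric.sphere c r)ᶜ w)) :
    HasWind c r (fun z => φ z - w) 0 := by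
  have hK : IsCompact (φ '' Metric.sphere c r) := (isCompact_sphere c r).image_of_continuousOn hφ
  have hex : ∀ v, v ∉ φ '' Metric.sphere c r → ∃ n, HasWind c r (fun z => φ z - v) n := by
    intro v hv
    refine HasWind.exists hr (by fun_prop) fun z hz h => hv ⟨z, hz, sub_eq_zero.1 h⟩
  choose! N hN using hex
  obtain ⟨R, hR⟩ := hK.isBounded.exists_norm_le
  have hw1 : ∃ w1 ∈ connectedComponentIn (φ '' Metric.sphere c r)ᶜ w, R < ‖w1‖ := by
    by_contra! hcon
    exact hub (isBounded_iff_forall_norm_le.2 ⟨R, hcon⟩)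
  obtain ⟨w1, hw1C, hw1R⟩ := hw1
  have hsub := connectedComponentIn_subset (φ '' Metric.sphere c r)ᶜ w
  have hcont : ContinuousOn N (connectedComponentIn (φ '' Metric.sphere c r)ᶜ w) := by
    intro v hv
    have hv' : v ∉ φ '' Metric.sphere c r := hsub hv
    apply ContinuousAt.continuousWithinAt
    have hev : ∀ᶠ u in 𝓝 v, N u = N v := by
      obtain ⟨δ, hδ, hball⟩ := Metric.isOpen_iff.1 hK.isClosed.isOpen_compl v hv'
      filter_upwards [Metric.ball_mem_nhds v hδ] with u hu
      have hu' : u ∉ φ '' Metric.sphere c r := hball hu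
      refine HasWind.unique hr (hN u hu') ?_
      refine HasWind.of_close hr (by fun_prop) (by fun_prop) ?_ (hN v hv')
      intro z hz
      have h1 : δ ≤ ‖φ z - v‖ := by
        by_contra! hlt
        rw [← dist_eq_norm] at hlt
        exact hball (Metric.mem_ball.2 hlt) ⟨z, hz, rfl⟩
      refine lt_of_lt_of_le ?_ h1
      rw [sub_sub_sub_cancel_left, ← dist_eq_norm, dist_comm]
      exact hu
    exact (continuousAt_const (y := N v)).congr (hev.mono fun u hu => hu.symm)
  have hwC : w ∈ connectedComponentIn (φ '' Metric.sphere c r)ᶜ w := mem_connectedComponentIn hw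
  have heq : N w = N w1 := isPreconnected_connectedComponentIn.constant hcont hwC hw1C
  have h1 : HasWind c r (fun z => φ z - w1) 0 := by
    have hw10 : -w1 ≠ 0 := by
      intro h
      have h2 := hR (φ (c + r * Complex.exp ((0 : ℝ) * Complex.I))) ⟨_, circ_mem hr 0, rfl⟩
      rw [neg_eq_zero] at h
      rw [h, norm_zero] at hw1R
      exact absurd (norm_nonneg _) (not_le.2 (h2.trans_lt hw1R))
    refine HasWind.of_close hr (φ := fun _ => -w1) (by fun_prop) (by fun_prop) ?_ (HasWind.const hw10)
    intro z hz
    have := hR (φ z) ⟨z, hz, rfl⟩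
    simp only [sub_neg_eq_add, sub_add_cancel, norm_neg]
    exact this.trans_lt hw1R
  have h2 := HasWind.unique hr h1 (hN w1 (hsub hw1C))
  have := hN w hw
  rwa [heq, ← h2] at this

theorem tendsto_sub_div (a : ℂ) :
    Tendsto (fun z : ℂ => (z - a) / z) (Bornology.cobounded ℂ) (𝓝 1) := by
  have h1 : Tendsto (fun z : ℂ => 1 - a * z⁻¹) (Bornology.cobounded ℂ) (𝓝 (1 - a * 0)) :=
    tendsto_const_nhds.sub (tendsto_const_nhds.mul tendsto_inv₀_cobounded)
  rw [mul_zero, sub_zero] at h1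
  refine h1.congr' ?_
  filter_upwards [Bornology.eventually_ne_cobounded (0 : ℂ)] with z hz
  rw [sub_div, div_self hz, div_eq_mul_inv]

theorem eventually_mem_X {M : ℕ} (ρ : ℝ) (c : Fin M → ℂ) :
    ∀ᶠ z in Bornology.cobounded ℂ, ∀ k, ρ < dist z (c k) := by
  rw [eventually_all]
  intro k
  have := (tendsto_dist_right_cobounded_atTop (c k)).eventually (eventually_gt_atTop ρ)
  exact this

theorem sphere_sub_X {M : ℕ} {ρ : ℝ} {c : Fin M → ℂ}
    (hsep : ∀ j k, j ≠ k → 2 * ρ < dist (c j) (c k)) {k : Fin M} {z : ℂ}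
    (hz : z ∈ Metric.sphere (c k) ρ) (j : Fin M) : ρ ≤ dist z (c j) := by
  rw [Metric.mem_sphere] at hz
  by_cases h : j = k
  · subst h; exact hz.ge
  · have h1 := hsep j k h
    have h2 := dist_triangle_left (c j) (c k) z
    linarith

theorem isClosed_X {M : ℕ} (ρ : ℝ) (c : Fin M → ℂ) :
    IsClosed {z : ℂ | ∀ k, ρ ≤ dist z (c k)} := by
  simp only [Set.ofPred_forall]
  exact isClosed_iInter fun k => isClosed_le continuous_const (by fun_prop)

theorem sum_wind {M : ℕ} {ρ : ℝ} (hρ : 0 < ρ) {c : Fin M → ℂ}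
    (hsep : ∀ j k, j ≠ k → 2 * ρ < dist (c j) (c k)) {ψ : ℂ → ℂ} {n : Fin M → ℤ} {m : ℤ}
    (hψ : ContinuousOn ψ {z | ∀ k, ρ ≤ dist z (c k)})
    (h0 : ∀ z, (∀ k, ρ ≤ dist z (c k)) → ψ z ≠ 0)
    (hw : ∀ k, HasWind (c k) ρ ψ (n k))
    (has : Tendsto (fun z => ψ z / z ^ m) (Bornology.cobounded ℂ) (𝓝 1)) :
    ∑ k, n k = m := by
  classical
  let X : Set ℂ := {z | ∀ k, ρ ≤ dist z (c k)}
  have hXne : ∀ z ∈ X, ∀ k, z - c k ≠ 0 := by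
    intro z hz k h
    have := hz k
    rw [dist_eq_norm, h, norm_zero] at this
    linarith
  let χ : ℂ → ℂ := fun z => ψ z * ∏ k, (z - c k) ^ (-n k)
  have hχc : ContinuousOn χ X := by
    refine hψ.mul (continuousOn_finsetProd _ fun k _ => ?_)
    refine ContinuousOn.zpow₀ (by fun_prop) _ fun z hz => Or.inl (hXne z hz k)
  have hχ0 : ∀ z ∈ X, χ z ≠ 0 := fun z hz =>
    mul_ne_zero (h0 z hz) (Finset.prod_ne_zero_iff.2 fun k _ => zpow_ne_zero _ (hXne z hz k))
  have hχw : ∀ k, HasWind (c k) ρ χ 0 := by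
    intro k
    have h1 : HasWind (c k) ρ (fun z => ∏ j, (z - c j) ^ (-n j))
        (∑ j, if j = k then -n j else 0) := by
      refine HasWind.prod hρ _ fun j _ => ?_
      by_cases hjk : j = k
      · subst hjk
        simpa using HasWind.center.zpow (-n j)
      · rw [if_neg hjk]
        have := (HasWind.sub_outside (c := c k) (a := c j) hρ
          (by have := hsep j k hjk; linarith)).zpow (-n j)
        simpa using this
    have := (hw k).mul hρ h1
    rw [Finset.sum_ite_eq' Finset.univ k] at this
    simp only [Finset.mem_univ, if_true, add_neg_cancel] at this
    exact this
  choose l hl hle using hχw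
  have hg : ∀ k, ∃ g : C(ℂ, ℂ), ∀ z ∈ Metric.sphere (c k) ρ, g z = l k z := by
    intro k
    obtain ⟨g, hg⟩ := ContinuousMap.exists_restrict_eq (s := Metric.sphere (c k) ρ)
      Metric.isClosed_sphere
      (⟨fun z => l k z, continuousOn_iff_continuous_domRestrict.1 (hl k)⟩ :
        C(Metric.sphere (c k) ρ, ℂ))
    exact ⟨g, fun z hz => DFunLike.congr_fun hg ⟨z, hz⟩⟩
  choose g hg using hg
  let χ' : ℂ → ℂ := fun z => if h : ∃ k, z ∈ Metric.closedBall (c k) ρ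
    then Complex.exp (g h.choose z) else χ z
  have hχ'ball : ∀ k, ∀ z ∈ Metric.closedBall (c k) ρ, χ' z = Complex.exp (g k z) := by
    intro k z hz
    have h : ∃ k, z ∈ Metric.closedBall (c k) ρ := ⟨k, hz⟩
    have h2 : h.choose = k := by
      by_contra hne
      have h3 := hsep _ _ hne
      have h4 := h.choose_spec
      rw [Metric.mem_closedBall] at h4 hz
      have := dist_triangle_left (c h.choose) (c k) z
      linarith
    simp only [χ', dif_pos h, h2]
  have hχ'X : ∀ z ∈ X, χ' z = χ z := by
    intro z hz
    by_cases h : ∃ k, z ∈ Metric.closedBall (c k) ρ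
    · obtain ⟨k, hk⟩ := h
      have hs : z ∈ Metric.sphere (c k) ρ := le_antisymm hk (hz k)
      rw [hχ'ball k z hk, hg k z hs, hle k z hs]
      simp
    · simp only [χ', dif_neg h]
  have hχ'0 : ∀ z, χ' z ≠ 0 := by
    intro z
    by_cases h : ∃ k, z ∈ Metric.closedBall (c k) ρ
    · obtain ⟨k, hk⟩ := h
      rw [hχ'ball k z hk]
      exact Complex.exp_ne_zero _
    · simp only [not_exists, Metric.mem_closedBall, not_le] at h
      rw [hχ'X z fun k => (h k).le]
      exact hχ0 z fun k => (h k).le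
  have hχ'c : Continuous χ' := by
    let T : Option (Fin M) → Set ℂ := fun o => o.elim X (fun k => Metric.closedBall (c k) ρ)
    refine (locallyFinite_of_finite T).continuous ?_ ?_ ?_
    · rw [Set.eq_univ_iff_forall]
      intro z
      rw [Set.mem_iUnion]
      by_cases h : ∃ k, z ∈ Metric.closedBall (c k) ρ
      · obtain ⟨k, hk⟩ := h
        exact ⟨some k, hk⟩
      · simp only [not_exists, Metric.mem_closedBall, not_le] at h
        exact ⟨none, fun k => (h k).le⟩
    · rintro (_ | k)
      · exact isClosed_X ρ c
      · exact Metric.isClosed_closedBall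
    · rintro (_ | k)
      · exact hχc.congr hχ'X
      · exact ((Complex.continuous_exp.comp (g k).continuous).continuousOn).congr (hχ'ball k)
  obtain ⟨Λ, hΛ, hΛe⟩ := exists_log χ' hχ'c hχ'0
  set N : ℤ := m - ∑ k, n k with hN
  let q : ℂ → ℂ := fun z => χ z / z ^ N
  have hq : Tendsto q (Bornology.cobounded ℂ) (𝓝 1) := by
    have h1 : Tendsto (fun z : ℂ => (ψ z / z ^ m) * ∏ k, ((z - c k) / z) ^ (-n k))
        (Bornology.cobounded ℂ) (𝓝 (1 * ∏ k : Fin M, (1 : ℂ) ^ (-n k))) := by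
      refine has.mul (tendsto_finsetProd _ fun k _ => ?_)
      exact (tendsto_sub_div (c k)).zpow₀ _ (Or.inl one_ne_zero)
    simp only [one_zpow, Finset.prod_const_one, mul_one] at h1
    refine h1.congr' ?_
    filter_upwards [Bornology.eventually_ne_cobounded (0 : ℂ)] with z hz
    simp only [q, χ, div_zpow, Finset.prod_div_distrib, hN]
    have : ∏ k, z ^ (-n k) = z ^ (-∑ k, n k) := by
      rw [← Finset.sum_neg_distrib]
      clear * - hz
      induction (Finset.univ : Finset (Fin M)) using Finset.induction_on with
      | empty => simp
      | insert a s ha ih => rw [Finset.prod_insert ha, Finset.sum_insert ha, ih, zpow_add₀ hz]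
    rw [this, sub_eq_add_neg, zpow_add₀ hz, div_mul_div_comm]
  have hev : ∀ᶠ z in Bornology.cobounded ℂ, ‖q z - 1‖ < 1 ∧ (∀ k, ρ < dist z (c k)) := by
    refine Filter.Eventually.and ?_ (eventually_mem_X ρ c)
    have := hq (Metric.ball_mem_nhds 1 one_pos)
    filter_upwards [this] with z hz
    simpa [dist_eq_norm] using hz
  obtain ⟨R, -, hR⟩ := (Metric.hasBasis_cobounded_compl_closedBall (0 : ℂ)).eventually_iff.1 hev
  set R' := max R 0 + 1 with hR'
  have hR'0 : 0 < R' := by positivity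
  have hout : ∀ z ∈ Metric.sphere (0 : ℂ) R', ‖q z - 1‖ < 1 ∧ (∀ k, ρ < dist z (c k)) := by
    intro z hz
    refine hR ?_
    simp only [Metric.mem_sphere] at hz
    simp only [Set.mem_compl_iff, Metric.mem_closedBall, not_le, hz]
    have := le_max_left R 0
    linarith
  have hS : Metric.sphere (0 : ℂ) R' ⊆ X := fun z hz k => ((hout z hz).2 k).le
  have w1 : HasWind 0 R' χ 0 :=
    ⟨Λ, hΛ.continuousOn, fun z hz => by simp [hΛe, hχ'X z (hS hz)]⟩
  have hz0 : ∀ z ∈ Metric.sphere (0 : ℂ) R', z ≠ 0 := fun z hz => by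
    simpa using sphere_sub_ne hR'0 hz
  have w2 : HasWind 0 R' q 0 := by
    refine HasWind.of_close_one ?_ fun z hz => (hout z hz).1
    refine (hχc.mono hS).div (ContinuousOn.zpow₀ continuousOn_id _ fun z hz => Or.inl (hz0 z hz)) ?_
    exact fun z hz => zpow_ne_zero _ (hz0 z hz)
  have w3 : HasWind 0 R' (fun z => z ^ N) N :=
    ⟨fun _ => 0, continuousOn_const, fun z hz => by simp⟩
  have w4 : HasWind 0 R' χ (N + 0) := (w3.mul hR'0 w2).congr fun z hz => by
    simp only [q]
    rw [mul_div_cancel₀]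
    exact zpow_ne_zero _ (hz0 z hz)
  have := w1.unique hR'0 w4
  omega

theorem sum_wind_zeros {M : ℕ} {ρ : ℝ} (hρ : 0 < ρ) {c : Fin M → ℂ}
    (hsep : ∀ j k, j ≠ k → 2 * ρ < dist (c j) (c k)) {n : Fin M → ℤ} (S : Finset ℂ) :
    ∀ (φ : ℂ → ℂ) (m : ℤ)
    (_ : ContinuousOn φ {z | ∀ k, ρ ≤ dist z (c k)})
    (_ : ∀ z, (∀ k, ρ ≤ dist z (c k)) → φ z = 0 → z ∈ S)
    (_ : ∀ a ∈ S, (∀ k, ρ < dist a (c k)) ∧ φ a = 0 ∧ ∃ d ≠ 0, HasDerivAt φ d a)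
    (_ : ∀ k, HasWind (c k) ρ φ (n k))
    (_ : Tendsto (fun z => φ z / z ^ m) (Bornology.cobounded ℂ) (𝓝 1)),
    ∑ k, n k = m - S.card := by
  classical
  induction S using Finset.induction_on with
  | empty =>
    intro φ m hφ h0 _ hw has
    rw [sum_wind hρ hsep hφ (fun z hz h => by simpa using h0 z hz h) hw has]
    simp
  | insert a S ha ih =>
    intro φ m hφ h0 hS hw has
    obtain ⟨haD, ha0, d, hd, hda⟩ := hS a (by simp)
    have hsl : ∀ z, z ≠ a → dslope φ a z = φ z * (z - a)⁻¹ := by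
      intro z hz
      rw [dslope_of_ne _ hz, slope_def_field, ha0, sub_zero, div_eq_mul_inv]
    have hnhds : {z : ℂ | ∀ k, ρ ≤ dist z (c k)} ∈ 𝓝 a := by
      have : ∀ᶠ z in 𝓝 a, ∀ k, ρ < dist z (c k) := by
        rw [eventually_all]
        intro k
        exact (by fun_prop : Continuous fun z : ℂ => dist z (c k)).continuousAt.eventually
          (lt_mem_nhds (haD k))
      exact this.mono fun z hz k => (hz k).le
    have key := ih (dslope φ a) (m - 1) ((continuousOn_dslope hnhds).2 ⟨hφ, hda.differentiableAt⟩)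
      ?_ ?_ ?_ ?_
    · rw [key, Finset.card_insert_of_notMem ha]
      push_cast
      ring
    · intro z hz h
      by_cases hza : z = a
      · subst hza
        rw [dslope_same, hda.deriv] at h
        exact absurd h hd
      · rw [hsl z hza] at h
        have h1 : φ z = 0 := by
          simpa [sub_eq_zero, hza] using h
        simpa [hza] using h0 z hz h1
    · intro b hb
      obtain ⟨hbD, hb0, e, he, heb⟩ := hS b (by simp [hb])
      have hba : b ≠ a := fun h => ha (h ▸ hb)
      have hba' : b - a ≠ 0 := sub_ne_zero.2 hba
      refine ⟨hbD, by rw [hsl b hba, hb0, zero_mul], e / (b - a), div_ne_zero he hba', ?_⟩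
      have h1 : HasDerivAt (fun z => φ z / (z - a)) ((e * (b - a) - φ b * 1) / (b - a) ^ 2) b :=
        heb.div ((hasDerivAt_id b).sub_const a) hba'
      rw [hb0, zero_mul, sub_zero, pow_two, mul_div_mul_right _ _ hba'] at h1
      have h2 := h1.congr_of_eventuallyEq (f₁ := dslope φ a) (by
        filter_upwards [eventually_ne_nhds hba] with z hz
        rw [hsl z hz, div_eq_mul_inv])
      exact h2
    · intro k
      have := (hw k).mul hρ ((HasWind.sub_outside hρ (haD k)).zpow (-1))
      simp only [zero_mul, add_zero, zpow_neg_one] at this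
      refine this.congr fun z hz => hsl z ?_
      rintro rfl
      exact (haD k).ne' hz
    · have h1 := has.mul ((tendsto_sub_div a).inv₀ one_ne_zero)
      rw [inv_one, mul_one] at h1
      refine h1.congr' ?_
      filter_upwards [Bornology.eventually_ne_cobounded (0 : ℂ), Bornology.eventually_ne_cobounded a] with z hz hza
      have := sub_ne_zero.2 hza
      rw [hsl z hza, zpow_sub_one₀ hz]
      field_simp

theorem sum_wind_zeros' {M : ℕ} {ρ : ℝ} (hρ : 0 < ρ) {c : Fin M → ℂ}
    (hsep : ∀ j k, j ≠ k → 2 * ρ < dist (c j) (c k)) {n : Fin M → ℤ}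
    (φ : ℂ → ℂ) (m : ℤ)
    (hφ : ContinuousOn φ {z | ∀ k, ρ ≤ dist z (c k)})
    (h0 : ∀ z, (∀ k, ρ ≤ dist z (c k)) → φ z = 0 →
      (∀ k, ρ < dist z (c k)) ∧ ∃ d ≠ 0, HasDerivAt φ d z)
    (hw : ∀ k, HasWind (c k) ρ φ (n k))
    (has : Tendsto (fun z => φ z / z ^ m) (Bornology.cobounded ℂ) (𝓝 1)) :
    ∃ S : Finset ℂ, (∀ z, z ∈ S ↔ (∀ k, ρ ≤ dist z (c k)) ∧ φ z = 0) ∧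
    ∑ k, n k = m - S.card := by
  let Z : Set ℂ := {z | (∀ k, ρ ≤ dist z (c k)) ∧ φ z = 0}
  have hZcl : IsClosed Z := by
    have := hφ.preimage_isClosed_of_isClosed (isClosed_X ρ c) (isClosed_singleton (x := (0 : ℂ)))
    exact this
  have hZb : Bornology.IsBounded Z := by
    have h1 : ∀ᶠ z in Bornology.cobounded ℂ, φ z / z ^ m ≠ 0 := has.eventually_ne one_ne_zero
    rw [← Bornology.isCobounded_compl_iff, Bornology.isCobounded_def]
    filter_upwards [h1] with z hz hz'
    rw [hz'.2, zero_div] at hz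
    exact hz rfl
  have hZc : IsCompact Z := Metric.isCompact_of_isClosed_isBounded hZcl hZb
  have hfin : Z.Finite := by
    by_contra hinf
    obtain ⟨x, hxZ, hx⟩ := Set.Infinite.exists_accPt_of_subset_isCompact hinf hZc subset_rfl
    obtain ⟨-, d, hd, hder⟩ := h0 x hxZ.1 hxZ.2
    have h1 := hder.eventually_ne (c := 0) hd
    rw [accPt_iff_frequently_nhdsNE] at hx
    exact hx (h1.mono fun z hz hzZ => hz hzZ.2)
  refine ⟨hfin.toFinset, by simp [Z], ?_⟩
  refine sum_wind_zeros hρ hsep hfin.toFinset φ m hφ (fun z hz h => by simp [Z, h]; exact hz) ?_ hw has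
  intro a ha
  rw [Set.Finite.mem_toFinset] at ha
  obtain ⟨h1, h2⟩ := h0 a ha.1 ha.2
  exact ⟨h1, ha.2, h2⟩


theorem strict_bdry {c ζ : ℂ} {ρ δ : ℝ} (hρ : 0 < ρ) (hζ : dist ζ c = ρ) {f f' : ℂ → ℂ}
    (hδ : 0 < δ)
    (hf : ContinuousOn f ({z | ρ ≤ dist z c} ∩ Metric.ball ζ δ))
    (hf' : ContinuousWithinAt f' ({z | ρ ≤ dist z c} ∩ Metric.ball ζ δ) ζ)
    (hd : ∀ z ∈ Metric.ball ζ δ, ρ < dist z c → HasDerivAt f (f' z) z) {ε : ℝ} (hε : 0 < ε) :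
    ∀ᶠ p : ℂ × ℂ in 𝓝 (ζ, ζ), ρ ≤ dist p.1 c → ρ ≤ dist p.2 c →
      ‖f p.1 - f p.2 - f' ζ * (p.1 - p.2)‖ ≤ ε * ‖p.1 - p.2‖ := by
  set a := ζ - c with ha
  have hna : ‖a‖ = ρ := by rw [ha, ← dist_eq_norm, hζ]
  have ha0 : a ≠ 0 := by
    intro h; rw [h, norm_zero] at hna; exact hρ.ne hna
  -- the logarithmic chart
  let s : ℂ → ℂ := fun z => Complex.log ((z - c) / a)
  have hs0 : s ζ = 0 := by simp [s, ← ha, div_self ha0]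
  have hsd : HasStrictDerivAt s (1 / a / ((ζ - c) / a)) ζ := by
    have h1 : HasStrictDerivAt (fun z => z - c) 1 ζ := (hasStrictDerivAt_id ζ).sub_const c
    have h2 : HasStrictDerivAt (fun z => (z - c) / a) (1 / a) ζ := h1.div_const a
    refine HasStrictDerivAt.clog h2 ?_
    rw [← ha, div_self ha0]
    exact Complex.one_mem_slitPlane
  obtain ⟨K, hKpos, hK⟩ := hsd.hasStrictFDerivAt.isBigO_sub.exists_pos
  rw [Asymptotics.isBigOWith_iff] at hK
  let e : ℂ → ℂ := fun u => c + a * Complex.exp u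
  have he : Continuous e := by fun_prop
  have he0 : e 0 = ζ := by simp [e, ha]
  have hdist : ∀ u, dist (e u) c = ρ * Real.exp u.re := by
    intro u
    simp [e, dist_eq_norm, Complex.norm_exp, hna]
  have hes : ∀ z, z ≠ c → e (s z) = z := by
    intro z hz
    simp only [e, s]
    rw [Complex.exp_log (div_ne_zero (sub_ne_zero.2 hz) ha0), mul_div_cancel₀ _ ha0]
    ring
  set ε' := ε / ((ρ + 1) * K) with hε'
  have hε'0 : 0 < ε' := by positivity
  have hev1 : ∀ᶠ z in 𝓝 ζ, ρ ≤ dist z c → ‖f' z - f' ζ‖ < ε' := by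
    have h1 := hf' (Metric.ball_mem_nhds (f' ζ) hε'0)
    rw [Filter.mem_map, mem_nhdsWithin_iff_eventually] at h1
    filter_upwards [h1, Metric.ball_mem_nhds ζ hδ] with z hz hz2 hz3
    have := hz ⟨hz3, hz2⟩
    simpa [dist_eq_norm] using this
  have hev2 : ∀ᶠ u in 𝓝 (0 : ℂ), ((ρ ≤ dist (e u) c → ‖f' (e u) - f' ζ‖ < ε') ∧
      e u ∈ Metric.ball ζ δ) ∧ ‖a * Complex.exp u‖ < ρ + 1 := by
    have ht : Tendsto e (𝓝 0) (𝓝 ζ) := by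
      have := he.tendsto 0
      rwa [he0] at this
    refine ((ht.eventually hev1).and (ht.eventually (Metric.ball_mem_nhds ζ hδ))).and ?_
    have h1 : Tendsto (fun u : ℂ => ‖a * Complex.exp u‖) (𝓝 0) (𝓝 ‖a * Complex.exp 0‖) :=
      (by fun_prop : Continuous fun u : ℂ => ‖a * Complex.exp u‖).tendsto 0
    refine h1.eventually (gt_mem_nhds ?_)
    rw [Complex.exp_zero, mul_one, hna]
    linarith
  obtain ⟨r, hr, hball⟩ := Metric.eventually_nhds_iff_ball.1 hev2
  let C : Set ℂ := Metric.ball 0 r ∩ {u | 0 < u.re}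
  have hCconv : Convex ℝ C := (convex_ball 0 r).inter (convex_halfSpace_re_gt 0)
  let h : ℂ → ℂ := fun u => f (e u) - f' ζ * e u
  have hre : ∀ u : ℂ, 0 ≤ u.re → ρ ≤ dist (e u) c := by
    intro u hu
    rw [hdist]
    exact le_mul_of_one_le_right hρ.le (Real.one_le_exp hu)
  have hre' : ∀ u : ℂ, 0 < u.re → ρ < dist (e u) c := by
    intro u hu
    rw [hdist]
    exact lt_mul_of_one_lt_right hρ (Real.one_lt_exp_iff.2 hu)
  have hder : ∀ u ∈ C, HasDerivWithinAt h ((f' (e u) - f' ζ) * (a * Complex.exp u)) C u := by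
    intro u hu
    have h1 : HasDerivAt e (a * Complex.exp u) u :=
      ((Complex.hasDerivAt_exp u).const_mul a).const_add c
    have h2 := (hd (e u) (hball u hu.1).1.2 (hre' u hu.2)).comp u h1
    have h3 := h2.sub (h1.const_mul (f' ζ))
    rw [← sub_mul] at h3
    exact h3.hasDerivWithinAt
  have hlip : ∀ u ∈ C, ∀ v ∈ C, ‖h u - h v‖ ≤ ε' * (ρ + 1) * ‖u - v‖ := by
    intro u hu v hv
    refine Convex.norm_image_sub_le_of_norm_hasDerivWithin_le hder ?_ hCconv hv hu
    intro x hx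
    rw [norm_mul]
    have h1 := ((hball x hx.1).1.1 (hre x (le_of_lt hx.2))).le
    have h2 := (hball x hx.1).2.le
    exact mul_le_mul h1 h2 (norm_nonneg _) hε'0.le
  have hcl : ∀ u ∈ Metric.ball (0 : ℂ) r, 0 ≤ u.re → ∀ v ∈ Metric.ball (0 : ℂ) r, 0 ≤ v.re →
      ‖h u - h v‖ ≤ ε' * (ρ + 1) * ‖u - v‖ := by
    have hlim : ∀ u ∈ Metric.ball (0 : ℂ) r, 0 ≤ u.re →
        Tendsto (fun t : ℝ => h (u + t)) (𝓝[>] 0) (𝓝 (h u)) ∧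
        ∀ᶠ t : ℝ in 𝓝[>] 0, u + t ∈ C := by
      intro u hu hu0
      have ht0 : Tendsto (fun t : ℝ => u + t) (𝓝[>] 0) (𝓝 u) := by
        have h1 : Tendsto (fun t : ℝ => u + t) (𝓝 0) (𝓝 (u + (0 : ℝ))) :=
          (by fun_prop : Continuous fun t : ℝ => u + t).tendsto 0
        simp only [Complex.ofReal_zero, add_zero] at h1
        exact h1.mono_left nhdsWithin_le_nhds
      have hmem : ∀ᶠ t : ℝ in 𝓝[>] 0, u + t ∈ C := by
        filter_upwards [ht0.eventually (Metric.isOpen_ball.mem_nhds hu), self_mem_nhdsWithin]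
          with t ht htp
        refine ⟨ht, ?_⟩
        have htp' : (0 : ℝ) < t := htp
        simp only [Set.mem_ofPred_eq, Complex.add_re, Complex.ofReal_re]
        linarith
      refine ⟨?_, hmem⟩
      have hfe : ContinuousWithinAt f ({z | ρ ≤ dist z c} ∩ Metric.ball ζ δ) (e u) :=
        hf (e u) ⟨hre u hu0, (hball u hu).1.2⟩
      have h2 : Tendsto (fun t : ℝ => e (u + t)) (𝓝[>] 0)
          (𝓝[{z | ρ ≤ dist z c} ∩ Metric.ball ζ δ] (e u)) := by
        refine tendsto_nhdsWithin_iff.2 ⟨(he.tendsto u).comp ht0, ?_⟩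
        filter_upwards [hmem] with t ht
        exact ⟨hre _ (le_of_lt ht.2), (hball _ ht.1).1.2⟩
      exact (Tendsto.comp hfe h2).sub (((he.tendsto u).comp ht0).const_mul (f' ζ))
    intro u hu hu0 v hv hv0
    obtain ⟨hu1, hu2⟩ := hlim u hu hu0
    obtain ⟨hv1, hv2⟩ := hlim v hv hv0
    refine le_of_tendsto (hu1.sub hv1).norm ?_
    filter_upwards [hu2, hv2] with t ht1 ht2
    have := hlip _ ht1 _ ht2
    rwa [add_sub_add_right_eq_sub] at this
  have hsc : Tendsto s (𝓝 ζ) (𝓝 0) := by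
    have := hsd.hasDerivAt.continuousAt.tendsto
    rwa [hs0] at this
  have hsball := hsc.eventually (Metric.ball_mem_nhds 0 hr)
  filter_upwards [hK, (hsball.prod_inl_nhds ζ : ∀ᶠ p : ℂ × ℂ in 𝓝 (ζ, ζ), s p.1 ∈ Metric.ball 0 r),
    (hsball.prod_inr_nhds ζ : ∀ᶠ p : ℂ × ℂ in 𝓝 (ζ, ζ), s p.2 ∈ Metric.ball 0 r)] with p hp h1 h2 hp1 hp2
  have hpc : ∀ z, ρ ≤ dist z c → z ≠ c := by
    rintro z hz rfl
    rw [dist_self] at hz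
    linarith
  have hsre : ∀ z, ρ ≤ dist z c → 0 ≤ (s z).re := by
    intro z hz
    simp only [s, Complex.log_re, norm_div, hna]
    refine Real.log_nonneg ((one_le_div hρ).2 ?_)
    rwa [← dist_eq_norm]
  have := hcl _ h1 (hsre _ hp1) _ h2 (hsre _ hp2)
  simp only [h, hes _ (hpc _ hp1), hes _ (hpc _ hp2)] at this
  calc ‖f p.1 - f p.2 - f' ζ * (p.1 - p.2)‖
      = ‖f p.1 - f' ζ * p.1 - (f p.2 - f' ζ * p.2)‖ := by congr 1; ring
    _ ≤ ε' * (ρ + 1) * ‖s p.1 - s p.2‖ := this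
    _ ≤ ε' * (ρ + 1) * (K * ‖p.1 - p.2‖) := by gcongr
    _ = ε * ‖p.1 - p.2‖ := by
      rw [hε']
      field_simp

theorem hopf {c : ℂ} {r : ℝ} (hr : 0 < r) {G : ℂ → ℂ → ℂ} (hsymm : ∀ z w, G z w = G w z)
    (hc : ContinuousOn (fun p : ℂ × ℂ => G p.1 p.2) (Metric.sphere c r ×ˢ Metric.sphere c r))
    (h0 : ∀ z ∈ Metric.sphere c r, ∀ w ∈ Metric.sphere c r, G z w ≠ 0) :
    ∃ n : ℤ, HasWind c r (fun z => G z z) (2 * n) ∧ ∀ z ∈ Metric.sphere c r, HasWind c r (G z) n := by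
  let γ : ℝ → ℂ := fun t => c + r * Complex.exp (t * Complex.I)
  have hγ : Continuous γ := by fun_prop
  have hγm : ∀ t, γ t ∈ Metric.sphere c r := fun t => circ_mem hr t
  have hγp : ∀ t, γ (t + 2 * Real.pi) = γ t := by
    intro t
    simp only [γ]
    push_cast
    rw [add_mul, Complex.exp_add, Complex.exp_two_pi_mul_I, mul_one]
  obtain ⟨L, hL, hLe⟩ := exists_log (fun p : ℝ × ℝ => G (γ p.1) (γ p.2))
    (hc.comp_continuous (f := fun p : ℝ × ℝ => (γ p.1, γ p.2)) (by fun_prop)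
      (fun p => ⟨hγm p.1, hγm p.2⟩)) (fun p => h0 _ (hγm _) _ (hγm _))
  obtain ⟨n, hn⟩ := exp_one_const (fun p : ℝ × ℝ => L (p.1, p.2 + 2 * Real.pi) - L p) (by fun_prop)
    (by
      intro p
      rw [Complex.exp_sub, hLe, hLe]
      simp only [hγp]
      exact div_self (h0 _ (hγm _) _ (hγm _))) (0, 0)
  obtain ⟨k, hk⟩ := exp_one_const (fun p : ℝ × ℝ => L (p.2, p.1) - L p) (by fun_prop)
    (by
      intro p
      rw [Complex.exp_sub, hLe, hLe]
      rw [hsymm]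
      exact div_self (h0 _ (hγm _) _ (hγm _))) (0, 0)
  have hk0 : ∀ s t, L (s, t) = L (t, s) := by
    intro s t
    have h1 := hk (0, 0)
    have h2 := hk (t, s)
    rw [← h1] at h2
    simp only [sub_self] at h2
    exact sub_eq_zero.1 h2
  have hn' : ∀ s t, L (s, t + 2 * Real.pi) = L (s, t) + n * (2 * Real.pi * Complex.I) := by
    intro s t
    have := hn (s, t)
    simp only at this
    linear_combination this
  refine ⟨n, ?_, ?_⟩
  · refine HasWind.of_lift hr (L := fun t => L (t, t)) (by fun_prop) (fun t => hLe (t, t)) ?_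
    intro t
    rw [hn', hk0, hn']
    push_cast
    ring
  · intro z hz
    have hz' : γ (Complex.arg (z - c)) = z := by
      have hnorm : ‖z - c‖ = r := by rwa [mem_sphere_iff_norm] at hz
      have h3 := Complex.norm_mul_exp_arg_mul_I (z - c)
      rw [hnorm] at h3
      simp only [γ, h3]
      ring
    refine HasWind.of_lift hr (L := fun t => L (Complex.arg (z - c), t)) (by fun_prop) ?_ ?_
    · intro t
      have := hLe (Complex.arg (z - c), t)
      simp only [hz'] at this
      exact this
    · intro t
      exact hn' _ t

theorem isPreconnected_D {M : ℕ} {ρ : ℝ} (hρ : 0 < ρ) {c : Fin M → ℂ}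
    (hsep : ∀ j k, j ≠ k → 2 * ρ < dist (c j) (c k)) :
    IsPreconnected {z : ℂ | ∀ k, ρ < dist z (c k)} := by
  refine isPreconnected_of_forall_pair ?_
  intro x hx y hy
  have hev : ∀ᶠ t in 𝓝[>] ρ, ((∀ k, t < dist x (c k)) ∧ (∀ k, t < dist y (c k))) ∧
      ∀ j k, j ≠ k → 2 * t < dist (c j) (c k) := by
    refine Filter.Eventually.filter_mono nhdsWithin_le_nhds ?_
    refine Filter.Eventually.and (Filter.Eventually.and ?_ ?_) ?_
    · exact eventually_all.2 fun k => gt_mem_nhds (hx k)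
    · exact eventually_all.2 fun k => gt_mem_nhds (hy k)
    · refine eventually_all.2 fun j => eventually_all.2 fun k => ?_
      by_cases hjk : j = k
      · simp [hjk]
      · have h1 : Tendsto (fun t : ℝ => 2 * t) (𝓝 ρ) (𝓝 (2 * ρ)) :=
          (by fun_prop : Continuous fun t : ℝ => 2 * t).tendsto ρ
        exact (h1.eventually (gt_mem_nhds (hsep j k hjk))).mono fun t ht _ => ht
  obtain ⟨t, ⟨⟨htx, hty⟩, hts⟩, htρ⟩ := (hev.and self_mem_nhdsWithin).exists
  have htρ' : ρ < t := htρ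
  have ht0 : 0 < t := hρ.trans htρ'
  let r : ℂ → ℂ := fun z => z + ∑ k, ((max 0 (t / ‖z - c k‖ - 1) : ℝ) : ℂ) * (z - c k)
  have hA : IsPreconnected (Set.range c)ᶜ := by
    refine ((Set.finite_range c).countable.isPathConnected_compl_of_one_lt_rank ?_).isConnected.isPreconnected
    rw [Complex.rank_real_complex]
    exact_mod_cast Nat.one_lt_two
  have hr : ContinuousOn r (Set.range c)ᶜ := by
    refine continuousOn_id.add (continuousOn_finsetSum _ fun k _ => ?_)
    have h1 : ContinuousOn (fun z : ℂ => t / ‖z - c k‖) (Set.range c)ᶜ := by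
      refine ContinuousOn.div (by fun_prop) (by fun_prop) ?_
      intro z hz h
      rw [norm_eq_zero, sub_eq_zero] at h
      exact hz ⟨k, h.symm⟩
    refine ContinuousOn.mul ?_ (by fun_prop)
    exact Complex.continuous_ofReal.comp_continuousOn
      (continuousOn_const.sup (h1.sub continuousOn_const))
  have hzero : ∀ z k, t ≤ dist z (c k) → max 0 (t / ‖z - c k‖ - 1) = 0 := by
    intro z k hz
    rw [dist_eq_norm] at hz
    refine max_eq_left ?_
    have : t / ‖z - c k‖ ≤ 1 := (div_le_one (ht0.trans_le hz)).2 hz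
    linarith
  have hfix : ∀ z, (∀ k, t ≤ dist z (c k)) → r z = z := by
    intro z hz
    simp only [r]
    rw [Finset.sum_eq_zero, add_zero]
    intro k _
    rw [hzero z k (hz k)]
    simp
  have hnotc : ∀ z, (∀ k, t < dist z (c k)) → z ∈ (Set.range c)ᶜ := by
    rintro z hz ⟨k, rfl⟩
    have := hz k
    rw [dist_self] at this
    linarith
  refine ⟨r '' (Set.range c)ᶜ, ?_, ⟨x, hnotc x htx, hfix x fun k => (htx k).le⟩,
    ⟨y, hnotc y hty, hfix y fun k => (hty k).le⟩, hA.image r hr⟩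
  rintro _ ⟨z, hz, rfl⟩
  by_cases h : ∀ k, t ≤ dist z (c k)
  · rw [hfix z h]
    exact fun k => htρ'.trans_le (h k)
  · push Not at h
    obtain ⟨k, hk⟩ := h
    have hoth : ∀ j, j ≠ k → t ≤ dist z (c j) := by
      intro j hj
      have h1 := hts j k hj
      have := dist_triangle_left (c j) (c k) z
      linarith
    have hpos : 0 < ‖z - c k‖ := by
      rw [norm_pos_iff, sub_ne_zero]
      rintro rfl
      exact hz ⟨k, rfl⟩
    have hrz : r z - c k = ((t / ‖z - c k‖ : ℝ) : ℂ) * (z - c k) := by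
      simp only [r]
      rw [Finset.sum_eq_single k]
      · rw [max_eq_right]
        · push_cast
          ring
        · rw [dist_eq_norm] at hk
          have : 1 ≤ t / ‖z - c k‖ := (one_le_div hpos).2 hk.le
          linarith
      · intro j _ hj
        rw [hzero z j (hoth j hj)]
        simp
      · simp
    have hrd : dist (r z) (c k) = t := by
      rw [dist_eq_norm, hrz, norm_mul, Complex.norm_real, Real.norm_eq_abs,
        abs_of_pos (div_pos ht0 hpos)]
      field_simp
    intro j
    by_cases hj : j = k
    · subst hj
      rw [hrd]
      exact htρ'
    · have h1 := hts j k hj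
      have := dist_triangle_left (c j) (c k) (r z)
      linarith


theorem closure_D {M : ℕ} {ρ : ℝ} (hρ : 0 < ρ) {c : Fin M → ℂ}
    (hsep : ∀ j k, j ≠ k → 2 * ρ < dist (c j) (c k)) :
    closure {z : ℂ | ∀ k, ρ < dist z (c k)} = {z : ℂ | ∀ k, ρ ≤ dist z (c k)} := by
  apply subset_antisymm
  · exact closure_minimal (fun z hz k => (hz k).le) (isClosed_X ρ c)
  · intro z hz
    by_cases h : ∀ k, ρ < dist z (c k)
    · exact subset_closure h
    · push Not at h
      obtain ⟨k, hk⟩ := h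
      have hk' : dist z (c k) = ρ := le_antisymm hk (hz k)
      have ht : Tendsto (fun t : ℝ => z + t * (z - c k)) (𝓝[>] 0) (𝓝 z) := by
        have h1 : Tendsto (fun t : ℝ => z + t * (z - c k)) (𝓝 0) (𝓝 (z + (0 : ℝ) * (z - c k))) :=
          (by fun_prop : Continuous fun t : ℝ => z + t * (z - c k)).tendsto 0
        simp only [Complex.ofReal_zero, zero_mul, add_zero] at h1
        exact h1.mono_left nhdsWithin_le_nhds
      refine mem_closure_of_tendsto ht ?_
      refine eventually_all.2 fun j => ?_
      by_cases hj : j = k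
      · subst hj
        filter_upwards [self_mem_nhdsWithin] with t ht
        have ht' : (0 : ℝ) < t := ht
        have h1 : z + t * (z - c j) - c j = ((1 + t : ℝ) : ℂ) * (z - c j) := by
          push_cast
          ring
        rw [dist_eq_norm, h1, norm_mul, Complex.norm_real, Real.norm_eq_abs,
          abs_of_pos (by linarith), ← dist_eq_norm, hk']
        nlinarith
      · have h1 := hsep j k hj
        have h2 := dist_triangle_left (c j) (c k) z
        have h3 : ρ < dist z (c j) := by linarith
        exact (ht.dist tendsto_const_nhds).eventually (lt_mem_nhds h3)

theorem isOpen_D {M : ℕ} (ρ : ℝ) (c : Fin M → ℂ) :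
    IsOpen {z : ℂ | ∀ k, ρ < dist z (c k)} := by
  simp only [Set.ofPred_forall]
  exact isOpen_iInter_of_finite fun k => isOpen_lt continuous_const (by fun_prop)

/-- Symmetric difference quotient, with the prescribed derivative on the diagonal. -/
noncomputable def dq (f f' : ℂ → ℂ) (z w : ℂ) : ℂ :=
  open Classical in if z = w then f' z else (f z - f w) / (z - w)

theorem dq_self (f f' : ℂ → ℂ) (z : ℂ) : dq f f' z z = f' z := by simp [dq]

theorem dq_ne (f f' : ℂ → ℂ) {z w : ℂ} (h : z ≠ w) : dq f f' z w = (f z - f w) / (z - w) := by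
  simp [dq, h]

theorem dq_symm (f f' : ℂ → ℂ) (z w : ℂ) : dq f f' z w = dq f f' w z := by
  by_cases h : z = w
  · rw [h]
  · rw [dq_ne _ _ h, dq_ne _ _ (Ne.symm h), ← neg_sub (f w), ← neg_sub w, neg_div_neg_eq]

theorem dq_cont {M : ℕ} {ρ : ℝ} (hρ : 0 < ρ) {c : Fin M → ℂ}
    (hsep : ∀ j k, j ≠ k → 2 * ρ < dist (c j) (c k)) {f f' : ℂ → ℂ}
    (hf : ContinuousOn f {z | ∀ k, ρ ≤ dist z (c k)})
    (hf' : ContinuousOn f' {z | ∀ k, ρ ≤ dist z (c k)})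
    (hdf : ∀ z, (∀ k, ρ < dist z (c k)) → HasDerivAt f (f' z) z)
    {a b : ℂ} (j : Fin M) (ha : a ∈ Metric.sphere (c j) ρ) (hb : ∀ k, ρ ≤ dist b (c k)) :
    ContinuousWithinAt (fun p : ℂ × ℂ => dq f f' p.1 p.2)
      ({z | ∀ k, ρ ≤ dist z (c k)} ×ˢ {z | ∀ k, ρ ≤ dist z (c k)}) (a, b) := by
  have haX : ∀ k, ρ ≤ dist a (c k) := sphere_sub_X hsep ha
  by_cases hab : a = b
  · subst hab
    -- neighbourhood of `a` where only the `j`-th disc matters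
    have hev : ∀ᶠ z in 𝓝 a, ∀ k, k ≠ j → ρ < dist z (c k) := by
      refine eventually_all.2 fun k => ?_
      by_cases hk : k = j
      · simp [hk]
      · have h1 := hsep k j hk
        have h2 := dist_triangle_left (c k) (c j) a
        rw [Metric.mem_sphere] at ha
        have h3 : ρ < dist a (c k) := by linarith
        exact ((by fun_prop : Continuous fun z : ℂ => dist z (c k)).continuousAt.eventually
          (lt_mem_nhds h3)).mono fun z hz _ => hz
    obtain ⟨δ, hδ, hball⟩ := Metric.eventually_nhds_iff_ball.1 hev
    have hsub : {z | ρ ≤ dist z (c j)} ∩ Metric.ball a δ ⊆ {z | ∀ k, ρ ≤ dist z (c k)} := by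
      rintro z ⟨hz1, hz2⟩ k
      by_cases hk : k = j
      · subst hk; exact hz1
      · exact (hball z hz2 k hk).le
    rw [Metric.continuousWithinAt_iff']
    intro ε hε
    have hs := strict_bdry hρ (Metric.mem_sphere.1 ha) hδ (hf.mono hsub)
      ((hf' a haX).mono hsub) (fun z hz hz2 => hdf z fun k => by
        by_cases hk : k = j
        · subst hk; exact hz2
        · exact hball z hz k hk) (half_pos hε)
    have hc : ∀ᶠ z in 𝓝 a, (∀ k, ρ ≤ dist z (c k)) → dist (f' z) (f' a) < ε := by
      have h1 := Metric.continuousWithinAt_iff'.1 (hf' a haX) ε hε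
      rw [eventually_nhdsWithin_iff] at h1
      exact h1
    rw [eventually_nhdsWithin_iff]
    filter_upwards [hs, (hc.prod_inl_nhds a :
      ∀ᶠ p : ℂ × ℂ in 𝓝 (a, a), (∀ k, ρ ≤ dist p.1 (c k)) → dist (f' p.1) (f' a) < ε)]
      with p hp1 hp2 hpX
    obtain ⟨z, w⟩ := p
    obtain ⟨hz, hw⟩ := hpX
    simp only at hp1 hp2 hz hw ⊢
    rw [dq_self]
    by_cases hzw : z = w
    · subst hzw
      rw [dq_self]
      exact hp2 hz
    · have h0 : z - w ≠ 0 := sub_ne_zero.2 hzw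
      have h0' : 0 < ‖z - w‖ := norm_pos_iff.2 h0
      rw [dq_ne _ _ hzw, dist_eq_norm]
      have h2 : (f z - f w) / (z - w) - f' a = (f z - f w - f' a * (z - w)) / (z - w) := by
        field_simp
      rw [h2, norm_div, div_lt_iff₀ h0']
      refine (hp1 (hz j) (hw j)).trans_lt ?_
      exact mul_lt_mul_of_pos_right (half_lt_self hε) h0'
  · have hev : ∀ᶠ p : ℂ × ℂ in 𝓝 (a, b), p.1 ≠ p.2 :=
      (isOpen_ne_fun continuous_fst continuous_snd).mem_nhds hab
    have h1 : ContinuousWithinAt (fun p : ℂ × ℂ => (f p.1 - f p.2) / (p.1 - p.2))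
        ({z | ∀ k, ρ ≤ dist z (c k)} ×ˢ {z | ∀ k, ρ ≤ dist z (c k)}) (a, b) := by
      refine ContinuousWithinAt.div (ContinuousWithinAt.sub ?_ ?_) (by fun_prop) (sub_ne_zero.2 hab)
      · exact (hf a haX).comp (f := Prod.fst) (x := (a, b)) continuous_fst.continuousWithinAt
          (fun p hp => hp.1)
      · exact (hf b hb).comp (f := Prod.snd) (x := (a, b)) continuous_snd.continuousWithinAt
          (fun p hp => hp.2)
    refine h1.congr_of_eventuallyEq ?_ (dq_ne _ _ hab)
    filter_upwards [nhdsWithin_le_nhds hev] with p hp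
    exact dq_ne _ _ hp

theorem tendsto_deriv_one {M : ℕ} {ρ : ℝ} {c : Fin M → ℂ} {f f' : ℂ → ℂ}
    (hdf : ∀ z, (∀ k, ρ < dist z (c k)) → HasDerivAt f (f' z) z)
    (hasymp : Tendsto (fun z => f z - z) (Bornology.cobounded ℂ) (𝓝 0)) :
    Tendsto f' (Bornology.cobounded ℂ) (𝓝 1) := by
  rw [Metric.tendsto_nhds]
  intro ε hε
  have hev : ∀ᶠ z in Bornology.cobounded ℂ, ‖f z - z‖ < ε / 2 ∧ (∀ k, ρ < dist z (c k)) := by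
    refine Filter.Eventually.and ?_ (eventually_mem_X ρ c)
    have := hasymp (Metric.ball_mem_nhds 0 (half_pos hε))
    filter_upwards [this] with z hz
    simpa using hz
  obtain ⟨R, -, hR⟩ := (Metric.hasBasis_cobounded_compl_closedBall (0 : ℂ)).eventually_iff.1 hev
  have h2 : ∀ᶠ z in Bornology.cobounded ℂ, z ∈ (Metric.closedBall (0 : ℂ) (R + 1))ᶜ :=
    Bornology.isBounded_def.1 Metric.isBounded_closedBall
  filter_upwards [h2] with z hz
  have hin : ∀ w ∈ Metric.closedBall z 1, w ∈ (Metric.closedBall (0 : ℂ) R)ᶜ := by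
    intro w hw hw'
    apply hz
    rw [Metric.mem_closedBall] at *
    have := dist_triangle_left z 0 w
    linarith
  have hd : ∀ w ∈ Metric.closedBall z 1, HasDerivAt (fun z => f z - z) (f' w - 1) w := by
    intro w hw
    exact (hdf w (hR (hin w hw)).2).sub (hasDerivAt_id w)
  have h3 : DiffContOnCl ℂ (fun z => f z - z) (Metric.ball z 1) := by
    refine ⟨fun w hw => (hd w (Metric.ball_subset_closedBall hw)).differentiableAt.differentiableWithinAt,
      fun w hw => (hd w (Metric.closure_ball_subset_closedBall hw)).continuousAt.continuousWithinAt⟩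
  have h4 := Complex.norm_deriv_le_of_forall_mem_sphere_norm_le one_pos h3
    (C := ε / 2) (fun w hw => (hR (hin w (Metric.sphere_subset_closedBall hw))).1.le)
  rw [(hd z (Metric.mem_closedBall_self zero_le_one)).deriv, div_one] at h4
  rw [dist_eq_norm]
  linarith

theorem tendsto_sub_div_id {f : ℂ → ℂ}
    (hasymp : Tendsto (fun z => f z - z) (Bornology.cobounded ℂ) (𝓝 0)) (w : ℂ) :
    Tendsto (fun z => (f z - w) / z) (Bornology.cobounded ℂ) (𝓝 1) := by
  have h1 := (hasymp.mul tendsto_inv₀_cobounded).add (tendsto_sub_div w)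
  rw [zero_mul, zero_add] at h1
  refine h1.congr fun z => ?_
  rw [← div_eq_mul_inv, ← add_div]
  congr 1
  ring

theorem conformal_map_globally_injective (M : ℕ) (ρ : ℝ) (hρ : 0 < ρ)
    (ζc : Fin M → ℂ)
    (hsep : ∀ j k, j ≠ k → 2 * ρ < dist (ζc j) (ζc k))
    (D : Set ℂ) (hD : D = {z : ℂ | ∀ k, ρ < dist z (ζc k)})
    (f f' : ℂ → ℂ)
    (hf : ContinuousOn f (closure D))
    (hf' : ContinuousOn f' (closure D))
    (hdf : ∀ z ∈ D, HasDerivAt f (f' z) z)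
    (hne : ∀ z ∈ closure D, f' z ≠ 0)
    (hasymp : Filter.Tendsto (fun z => f z - z) (Bornology.cobounded ℂ) (nhds 0))
    (hinj : Set.InjOn f (frontier D))
    (hnoencl : ∀ j k : Fin M, j ≠ k → ∀ z ∈ f '' Metric.sphere (ζc j) ρ,
      ¬ Bornology.IsBounded (connectedComponentIn (f '' Metric.sphere (ζc k) ρ)ᶜ z)) :
    Set.InjOn f D ∧
      Set.BijOn f D
        (unboundedComplementComponent (⋃ k, f '' Metric.sphere (ζc k) ρ)) := by
  subst hD
  rw [(isOpen_D ρ ζc).frontier_eq, closure_D hρ hsep] at hinj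
  rw [closure_D hρ hsep] at hf hf' hne
  have hsX : ∀ k, Metric.sphere (ζc k) ρ ⊆ {z : ℂ | ∀ k, ρ ≤ dist z (ζc k)} :=
    fun k z hz => sphere_sub_X hsep hz
  have hsF : ∀ k, ∀ z ∈ Metric.sphere (ζc k) ρ, z ∈ {z : ℂ | ∀ k, ρ ≤ dist z (ζc k)} \
      {z : ℂ | ∀ k, ρ < dist z (ζc k)} :=
    fun k z hz => ⟨hsX k hz, fun h => (h k).ne' hz⟩
  have hFs : ∀ z, (∀ k, ρ ≤ dist z (ζc k)) → (¬ ∀ k, ρ < dist z (ζc k)) →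
      ∃ k, z ∈ Metric.sphere (ζc k) ρ := by
    intro z hz h
    push Not at h
    obtain ⟨k, hk⟩ := h
    exact ⟨k, le_antisymm hk (hz k)⟩
  have hfs : ∀ k, ContinuousOn f (Metric.sphere (ζc k) ρ) := fun k => hf.mono (hsX k)
  -- Step 1 : points of `D` are not mapped to the boundary curves
  have hdqX : ∀ j, ∀ a ∈ Metric.sphere (ζc j) ρ,
      ContinuousOn (dq f f' a) {z : ℂ | ∀ k, ρ ≤ dist z (ζc k)} := by
    intro j a ha b hb
    exact (dq_cont hρ hsep hf hf' hdf j ha hb).comp (f := fun z => (a, z)) (x := b)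
      (by fun_prop) (fun z hz => ⟨hsX j ha, hz⟩)
  have hdq0 : ∀ j, ∀ a ∈ Metric.sphere (ζc j) ρ, ∀ b, (∀ k, ρ ≤ dist b (ζc k)) →
      dq f f' a b = 0 → a ≠ b ∧ f a = f b ∧ (∀ k, ρ < dist b (ζc k)) := by
    intro j a ha b hb h
    by_cases hab : a = b
    · subst hab
      rw [dq_self] at h
      exact absurd h (hne a hb)
    · rw [dq_ne _ _ hab, div_eq_zero_iff, or_iff_left (sub_ne_zero.2 hab), sub_eq_zero] at h
      refine ⟨hab, h, ?_⟩
      by_contra hcon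
      exact hab (hinj (hsF j a ha) ⟨hb, hcon⟩ h)
  have hhopf : ∀ j, ∃ n : ℤ, HasWind (ζc j) ρ f' (2 * n) ∧
      ∀ z ∈ Metric.sphere (ζc j) ρ, HasWind (ζc j) ρ (dq f f' z) n := by
    intro j
    obtain ⟨n, hn1, hn2⟩ := hopf hρ (c := ζc j) (G := dq f f') (dq_symm f f') (by
      rintro ⟨a, b⟩ ⟨ha, hb⟩
      exact (dq_cont hρ hsep hf hf' hdf j ha (hsX j hb)).mono (Set.prod_mono (hsX j) (hsX j)))
      (by
        intro a ha b hb h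
        obtain ⟨h1, h2, h3⟩ := hdq0 j a ha b (hsX j hb) h
        exact (h3 j).ne' hb)
    exact ⟨n, hn1.congr fun z _ => (dq_self f f' z).symm, hn2⟩
  choose n hn1 hn2 using hhopf
  have hsum : ∑ k, 2 * n k = 0 := by
    refine sum_wind hρ hsep hf' hne hn1 ?_
    simpa using tendsto_deriv_one hdf hasymp
  have hcard : ∀ j, ∀ a ∈ Metric.sphere (ζc j) ρ, ∃ S : Finset ℂ,
      (∀ z, z ∈ S ↔ (∀ k, ρ ≤ dist z (ζc k)) ∧ dq f f' a z = 0) ∧ n j = -S.card := by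
    intro j a ha
    obtain ⟨S, hS, hSn⟩ := sum_wind_zeros' hρ hsep (n := fun k => if k = j then n k else 0)
      (dq f f' a) 0 (hdqX j a ha) (by
        intro b hb h
        obtain ⟨hab, h2, h3⟩ := hdq0 j a ha b hb h
        have hab' : a - b ≠ 0 := sub_ne_zero.2 hab
        refine ⟨h3, -f' b / (a - b), div_ne_zero (neg_ne_zero.2 (hne b hb)) hab', ?_⟩
        have h4 : HasDerivAt (fun z => (f a - f z) / (a - z))
            ((-f' b * (a - b) - (f a - f b) * (-1)) / (a - b) ^ 2) b :=
          ((hdf b h3).const_sub (f a)).div ((hasDerivAt_id b).const_sub a) hab'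
        rw [h2, sub_self, zero_mul, sub_zero, pow_two, mul_div_mul_right _ _ hab'] at h4
        refine h4.congr_of_eventuallyEq ?_
        filter_upwards [eventually_ne_nhds (Ne.symm hab)] with z hz
        rw [dq_ne _ _ (Ne.symm hz), h2]) (by
        intro k
        by_cases hk : k = j
        · subst hk
          rw [if_pos rfl]
          exact hn2 k a ha
        · rw [if_neg hk]
          have hak : ρ < dist a (ζc k) := by
            have h1 := hsep k j hk
            have h2 := dist_triangle_left (ζc k) (ζc j) a
            rw [Metric.mem_sphere] at ha
            linarith
          have h1 : HasWind (ζc k) ρ (fun z => f z - f a) 0 := by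
            refine HasWind.of_unbounded hρ (hfs k) ?_
              (hnoencl j k (Ne.symm hk) _ ⟨a, ha, rfl⟩)
            rintro ⟨b, hb, hba⟩
            have := hinj (hsF k b hb) (hsF j a ha) hba
            subst this
            exact hak.ne' hb
          have h2 := h1.mul hρ ((HasWind.sub_outside hρ hak).zpow (-1))
          simp only [zero_mul, add_zero, zpow_neg_one] at h2
          refine h2.congr fun z hz => ?_
          have hza : z ≠ a := by
            rintro rfl
            exact hak.ne' hz
          rw [dq_symm, dq_ne _ _ hza, div_eq_mul_inv]) (by
        simp only [zpow_zero, div_one]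
        have h1 := (tendsto_sub_div_id hasymp (f a)).div (tendsto_sub_div a) one_ne_zero
        rw [div_one] at h1
        refine h1.congr' ?_
        filter_upwards [Bornology.eventually_ne_cobounded (0 : ℂ),
          Bornology.eventually_ne_cobounded a] with z hz hza
        rw [dq_symm, dq_ne _ _ hza]
        simp only [Pi.div_apply]
        rw [div_div_div_cancel_right₀ hz])
    refine ⟨S, hS, ?_⟩
    rw [Finset.sum_ite_eq' Finset.univ j] at hSn
    simpa using hSn
  have hn0 : ∀ j, n j = 0 := by
    have hle : ∀ j, n j ≤ 0 := by
      intro j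
      obtain ⟨S, -, hS⟩ := hcard j _ (circ_mem hρ 0)
      omega
    have hs : ∑ k, n k = 0 := by
      rw [← Finset.mul_sum] at hsum
      omega
    intro j
    exact (Finset.sum_eq_zero_iff_of_nonpos fun k _ => hle k).1 hs j (Finset.mem_univ j)
  have hstep1 : ∀ j, ∀ a ∈ Metric.sphere (ζc j) ρ, ∀ b, (∀ k, ρ < dist b (ζc k)) → f b ≠ f a := by
    intro j a ha b hb hab
    obtain ⟨S, hS, hSn⟩ := hcard j a ha
    rw [hn0 j] at hSn
    have hS0 : S = ∅ := by
      rw [← Finset.card_eq_zero]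
      omega
    have hbne : a ≠ b := by
      rintro rfl
      exact (hb j).ne' ha
    have : b ∈ S := (hS b).2 ⟨fun k => (hb k).le, by rw [dq_ne _ _ hbne, hab, sub_self, zero_div]⟩
    rw [hS0] at this
    simp at this
  -- Step 2 : points of the unbounded component have exactly one preimage
  have hcount : ∀ w ∈ unboundedComplementComponent (⋃ k, f '' Metric.sphere (ζc k) ρ),
      ∃ S : Finset ℂ, (∀ z, z ∈ S ↔ (∀ k, ρ ≤ dist z (ζc k)) ∧ f z - w = 0) ∧ S.card = 1 := by
    rintro w ⟨hwE, hwU⟩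
    obtain ⟨S, hS, hSn⟩ := sum_wind_zeros' hρ hsep (n := fun _ => 0)
      (fun z => f z - w) 1 (by fun_prop) (by
        intro b hb h
        have hbD : ∀ k, ρ < dist b (ζc k) := by
          by_contra hcon
          obtain ⟨k, hk⟩ := hFs b hb hcon
          exact hwE (Set.mem_iUnion.2 ⟨k, b, hk, sub_eq_zero.1 h⟩)
        exact ⟨hbD, f' b, hne b hb, (hdf b hbD).sub_const w⟩) (by
        intro k
        have hsub : f '' Metric.sphere (ζc k) ρ ⊆ ⋃ k, f '' Metric.sphere (ζc k) ρ :=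
          Set.subset_iUnion (fun k => f '' Metric.sphere (ζc k) ρ) k
        refine HasWind.of_unbounded hρ (hfs k) (fun h => hwE (hsub h)) fun hbd => hwU ?_
        exact hbd.subset (connectedComponentIn_mono w (Set.compl_subset_compl.2 hsub)))
      (by simpa using tendsto_sub_div_id hasymp w)
    refine ⟨S, hS, ?_⟩
    simp only [Finset.sum_const_zero] at hSn
    omega
  -- Step 3 : `f` maps `D` into the unbounded component
  have hfcob : Tendsto f (Bornology.cobounded ℂ) (Bornology.cobounded ℂ) := by
    rw [← tendsto_norm_atTop_iff_cobounded]
    have h1 : ∀ᶠ z in Bornology.cobounded ℂ, ‖f z - z‖ < 1 := by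
      have := hasymp (Metric.ball_mem_nhds 0 one_pos)
      filter_upwards [this] with z hz
      simpa using hz
    have h2 : Tendsto (fun z : ℂ => ‖z‖ - 1) (Bornology.cobounded ℂ) atTop :=
      tendsto_atTop_add_const_right _ (-1) tendsto_norm_cobounded_atTop
    refine tendsto_atTop_mono' _ ?_ h2
    filter_upwards [h1] with z hz
    have := norm_sub_norm_le z (f z)
    rw [norm_sub_rev] at this
    linarith
  have hmaps : Set.MapsTo f {z : ℂ | ∀ k, ρ < dist z (ζc k)}
      (unboundedComplementComponent (⋃ k, f '' Metric.sphere (ζc k) ρ)) := by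
    have hsub : f '' {z : ℂ | ∀ k, ρ < dist z (ζc k)} ⊆ (⋃ k, f '' Metric.sphere (ζc k) ρ)ᶜ := by
      rintro _ ⟨b, hb, rfl⟩ h
      obtain ⟨k, a, ha, hab⟩ := Set.mem_iUnion.1 h
      exact hstep1 k a ha b hb hab.symm
    have hpre : IsPreconnected (f '' {z : ℂ | ∀ k, ρ < dist z (ζc k)}) :=
      (isPreconnected_D hρ hsep).image f (hf.mono fun z hz k => (hz k).le)
    intro z hz
    refine ⟨hsub ⟨z, hz, rfl⟩, fun hbd => ?_⟩
    have hbd2 := hbd.subset (hpre.subset_connectedComponentIn ⟨z, hz, rfl⟩ hsub)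
    have hev := (hfcob.eventually (Bornology.isBounded_def.1 hbd2)).and (eventually_mem_X ρ ζc)
    obtain ⟨u, hu1, hu2⟩ := hev.exists
    exact hu1 ⟨u, hu2, rfl⟩
  have hinjD : Set.InjOn f {z : ℂ | ∀ k, ρ < dist z (ζc k)} := by
    intro a ha b hb hab
    obtain ⟨S, hS, hS1⟩ := hcount _ (hmaps ha)
    obtain ⟨s, rfl⟩ := Finset.card_eq_one.1 hS1
    have h1 := (hS a).2 ⟨fun k => (ha k).le, sub_self _⟩
    have h2 := (hS b).2 ⟨fun k => (hb k).le, by rw [hab, sub_self]⟩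
    rw [Finset.mem_singleton] at h1 h2
    rw [h1, h2]
  refine ⟨hinjD, hmaps, hinjD, ?_⟩
  intro w hw
  obtain ⟨S, hS, hS1⟩ := hcount w hw
  obtain ⟨s, rfl⟩ := Finset.card_eq_one.1 hS1
  obtain ⟨h1, h2⟩ := (hS s).1 (Finset.mem_singleton_self s)
  refine ⟨s, ?_, sub_eq_zero.1 h2⟩
  by_contra hcon
  obtain ⟨k, hk⟩ := hFs s h1 hcon
  exact hw.1 (Set.mem_iUnion.2 ⟨k, s, hk, sub_eq_zero.1 h2⟩)
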